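/- Let γ be a symmetrical graph (possibly with loops) on I = {1,2,3,4,5,6} such that 13 ∈ E(γ), 46 ∈ E(γ), and every 2-connected claw-o-heavy and P6-γ-heavy graph is hamiltonian. Then none of 11, 16, 66 is an edge of γ. -/

import Mathlib

/-- A graph is 2-connected if it has at least 3 vertices and deleting any
single vertex leaves a connected graph. -/
def TwoConnected {V : Type*} [Fintype V] (G : SimpleGraph V) : Prop :=
  3 ≤ Fintype.card V ∧ ∀ v : V, (G.induce ({v}ᶜ : Set V)).Connected

/-- A graph `G` of order `n` is claw-o-heavy if every induced copy of the claw `K_{1,3}`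
(with center `a` and leaves `b₁, b₂, b₃`) contains two nonadjacent vertices whose
degree sum in `G` is at least `n`. -/
def ClawOHeavy {V : Type*} [Fintype V] (G : SimpleGraph V) [DecidableRel G.Adj] : Prop :=
  ∀ a b₁ b₂ b₃ : V, b₁ ≠ b₂ → b₁ ≠ b₃ → b₂ ≠ b₃ →
    G.Adj a b₁ → G.Adj a b₂ → G.Adj a b₃ →
    ¬ G.Adj b₁ b₂ → ¬ G.Adj b₁ b₃ → ¬ G.Adj b₂ b₃ →
    ∃ u v : V, u ∈ ({a, b₁, b₂, b₃} : Set V) ∧ v ∈ ({a, b₁, b₂, b₃} : Set V) ∧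
      u ≠ v ∧ ¬ G.Adj u v ∧ Fintype.card V ≤ G.degree u + G.degree v

/-- `v 0, v 1, …, v 5` is an induced path on 6 vertices in `G`. -/
def IsInducedP6 {V : Type*} (G : SimpleGraph V) (v : Fin 6 → V) : Prop :=
  Function.Injective v ∧
    ∀ i j : Fin 6, G.Adj (v i) (v j) ↔ (i.val + 1 = j.val ∨ j.val + 1 = i.val)

/- The paper indexes the vertices of `P₆` by `I = {1,…,6}`; here we use `Fin 6 = {0,…,5}`
(so paper-index `i` corresponds to `i - 1 : Fin 6`).  A graph (possibly with loops) on `I`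
is modelled as a set of unordered pairs (`Sym2 (Fin 6)`); a loop at `i` is `s(i, i)`. -/

/-- `γ` is symmetrical: `ij ∈ E(γ)` iff `(7-i)(7-j) ∈ E(γ)` (in `Fin 6` terms,
the map `i ↦ 7 - i` on `{1,…,6}` is `Fin.rev : i ↦ 5 - i`). -/
def SymmetricalGamma (γ : Set (Sym2 (Fin 6))) : Prop :=
  ∀ e : Sym2 (Fin 6), e ∈ γ ↔ e.map Fin.rev ∈ γ

/-- A graph `G` of order `n` is `P₆`-`γ`-heavy if for every induced path
`v 0, …, v 5` on 6 vertices there is an edge (or loop) `ij` of `γ` with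
`d(v i) + d(v j) ≥ n`. -/
def P6GammaHeavy {V : Type*} [Fintype V] (G : SimpleGraph V) [DecidableRel G.Adj]
    (γ : Set (Sym2 (Fin 6))) : Prop :=
  ∀ v : Fin 6 → V, IsInducedP6 G v →
    ∃ i j : Fin 6, s(i, j) ∈ γ ∧ Fintype.card V ≤ G.degree (v i) + G.degree (v j)

/-- `γ₁`, with paper edge set `{14,15,16,24,25,26,34,35,36}`. -/
def gamma1 : Set (Sym2 (Fin 6)) :=
  {s(0,3), s(0,4), s(0,5), s(1,3), s(1,4), s(1,5), s(2,3), s(2,4), s(2,5)}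

/-- `γ₂`, with paper edge set `{11,12,14,15,16,25,26,36,56,66}`. -/
def gamma2 : Set (Sym2 (Fin 6)) :=
  {s(0,0), s(0,1), s(0,3), s(0,4), s(0,5), s(1,4), s(1,5), s(2,5), s(4,5), s(5,5)}

/-- `γ₃`, with paper edge set `{13,14,15,25,26,36,46}`. -/
def gamma3 : Set (Sym2 (Fin 6)) :=
  {s(0,2), s(0,3), s(0,4), s(1,4), s(1,5), s(2,5), s(3,5)}

/-- The cells of the counterexample: a central clique `core`, and for each `i : Fin 3` a clique
`petal i` attached to the core, a vertex `foot i` attached to the petal, and a triangle formed by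
`foot i`, `corner i` and `tip i`. The three corners form a triangle. -/
inductive Cell
  | core
  | petal (i : Fin 3)
  | foot (i : Fin 3)
  | corner (i : Fin 3)
  | tip (i : Fin 3)
  deriving DecidableEq, Fintype

namespace Cell

/-- Whether distinct vertices lying in the given cells are adjacent. -/
def rel : Cell → Cell → Bool
  | core, core => true
  | core, petal _ => true
  | petal _, core => true
  | petal i, petal j => i == j
  | petal i, foot j => i == j
  | foot i, petal j => i == j
  | foot i, foot j => i == j
  | foot i, corner j => i == j
  | corner i, foot j => i == j
  | foot i, tip j => i == j
  | tip i, foot j => i == j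
  | corner _, corner _ => true
  | corner i, tip j => i == j
  | tip i, corner j => i == j
  | tip i, tip j => i == j
  | _, _ => false

/-- The common degree of the vertices in a cell. -/
def degree : Cell → ℕ
  | core => 40
  | petal _ => 25
  | foot _ => 10
  | corner _ => 4
  | tip _ => 2

theorem rel_comm : ∀ c d : Cell, rel c d = rel d c := by decide +kernel

/-- The cell of a vertex: the feet, corners and tips come first, followed by three petals of
size `8` and the core of size `17`. -/
def ofVertex (v : Fin 50) : Cell :=
  if v.val < 3 then foot (Fin.ofNat 3 v.val)
  else if v.val < 6 then corner (Fin.ofNat 3 v.val)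
  else if v.val < 9 then tip (Fin.ofNat 3 v.val)
  else if v.val < 33 then petal (Fin.ofNat 3 v.val)
  else core

theorem claw_heavy : ∀ a b : Cell, rel a b → ∀ c, rel a c → ¬ rel b c → ∀ d, rel a d →
    ¬ rel b d → ¬ rel c d → 50 ≤ b.degree + c.degree := by decide +kernel

set_option synthInstance.maxHeartbeats 400000 in
set_option synthInstance.maxSize 1000 in
theorem path_heavy : ∀ a b : Cell, rel a b → ∀ c, rel b c → ¬ rel a c →
    ∀ d, rel c d → ¬ rel a d → ¬ rel b d →
    ∀ e, rel d e → ¬ rel a e → ¬ rel b e → ¬ rel c e →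
    ∀ f, rel e f → ¬ rel a f → ¬ rel b f → ¬ rel c f → ¬ rel d f →
      50 ≤ a.degree + c.degree ∨ 50 ≤ d.degree + f.degree ∨
        (25 ≤ a.degree ∧ 25 ≤ f.degree) := by decide +kernel

end Cell

/-- The blow-up of the cell structure to a graph on `50` vertices. -/
def blowup : SimpleGraph (Fin 50) where
  Adj u v := u ≠ v ∧ Cell.rel (Cell.ofVertex u) (Cell.ofVertex v)
  symm := ⟨fun u v h => ⟨h.1.symm, by rw [Cell.rel_comm]; exact h.2⟩⟩
  loopless := ⟨fun _ h => h.1 rfl⟩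

instance : DecidableRel blowup.Adj := fun u v =>
  inferInstanceAs (Decidable (u ≠ v ∧ Cell.rel (Cell.ofVertex u) (Cell.ofVertex v)))

namespace blowup

theorem rel_of_adj {u v : Fin 50} (h : blowup.Adj u v) :
    Cell.rel (Cell.ofVertex u) (Cell.ofVertex v) := h.2

theorem not_rel_of_not_adj {u v : Fin 50} (hne : u ≠ v) (h : ¬ blowup.Adj u v) :
    ¬ Cell.rel (Cell.ofVertex u) (Cell.ofVertex v) := fun hr => h ⟨hne, hr⟩

theorem degree_eq : ∀ v, blowup.degree v = (Cell.ofVertex v).degree := by decide +kernel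

theorem clawOHeavy : ClawOHeavy blowup := by
  intro a b₁ b₂ b₃ h12 h13 h23 ha1 ha2 ha3 hn12 hn13 hn23
  refine ⟨b₁, b₂, by simp, by simp, h12, hn12, ?_⟩
  rw [degree_eq, degree_eq, Fintype.card_fin]
  exact Cell.claw_heavy _ _ (rel_of_adj ha1) _ (rel_of_adj ha2) (not_rel_of_not_adj h12 hn12) _
    (rel_of_adj ha3) (not_rel_of_not_adj h13 hn13) (not_rel_of_not_adj h23 hn23)

theorem heavy_of_isInducedP6 {v : Fin 6 → Fin 50} (hv : IsInducedP6 blowup v) :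
    50 ≤ blowup.degree (v 0) + blowup.degree (v 2) ∨
      50 ≤ blowup.degree (v 3) + blowup.degree (v 5) ∨
        (25 ≤ blowup.degree (v 0) ∧ 25 ≤ blowup.degree (v 5)) := by
  obtain ⟨hinj, hadj⟩ := hv
  have rel (i j : Fin 6) (h : i.val + 1 = j.val) :
      Cell.rel (Cell.ofVertex (v i)) (Cell.ofVertex (v j)) :=
    rel_of_adj ((hadj i j).2 (Or.inl h))
  have not_rel (i j : Fin 6) (h : i.val + 1 < j.val) :
      ¬ Cell.rel (Cell.ofVertex (v i)) (Cell.ofVertex (v j)) := by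
    refine not_rel_of_not_adj (fun hij => ?_) (fun hij => ?_)
    · have := congrArg Fin.val (hinj hij)
      omega
    · have := (hadj i j).1 hij
      omega
  simp only [degree_eq]
  exact Cell.path_heavy _ _ (rel 0 1 (by decide)) _ (rel 1 2 (by decide))
    (not_rel 0 2 (by decide)) _ (rel 2 3 (by decide)) (not_rel 0 3 (by decide))
    (not_rel 1 3 (by decide)) _ (rel 3 4 (by decide)) (not_rel 0 4 (by decide))
    (not_rel 1 4 (by decide)) (not_rel 2 4 (by decide)) _ (rel 4 5 (by decide))
    (not_rel 0 5 (by decide)) (not_rel 1 5 (by decide)) (not_rel 2 5 (by decide))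
    (not_rel 3 5 (by decide))

/-- The root of a spanning tree of the graph without the vertex `v`. -/
def root (v : Fin 50) : Fin 50 := if v = 49 then 48 else 49

/-- The parent of `u` in a spanning tree of the graph without the vertex `v`. -/
def parent (v u : Fin 50) : Fin 50 :=
  if u.val < 3 then (if v = u + 9 then u + 12 else u + 9)
  else if u.val < 6 then
    (if v = u - 3 then (if u = 5 then 3 else u + 1) else u - 3)
  else if u.val < 9 then (if v = u - 6 then u - 3 else u - 6)
  else root v

/-- A function decreasing along `parent v`. -/
def height (v u : Fin 50) : ℕ :=
  if u = root v then 0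
  else if u.val < 3 then 2
  else if u.val < 6 then (if v = u - 3 then 4 else 3)
  else if u.val < 9 then 5
  else 1

theorem parent_spec : ∀ v u : Fin 50, u ≠ v → u ≠ root v →
    parent v u ≠ v ∧ blowup.Adj u (parent v u) ∧ height v (parent v u) < height v u := by
  decide +kernel

theorem root_ne : ∀ v : Fin 50, root v ≠ v := by decide +kernel

theorem twoConnected : TwoConnected blowup := by
  refine ⟨by simp, fun v => ?_⟩
  have key : ∀ (k : ℕ) (u : Fin 50) (hu : u ≠ v), height v u < k →
      (blowup.induce ({v}ᶜ : Set (Fin 50))).Reachable ⟨u, hu⟩ ⟨root v, root_ne v⟩ := by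
    intro k
    induction k with
    | zero => intro u hu h; omega
    | succ k ih =>
      intro u hu h
      by_cases hr : u = root v
      · subst hr; exact SimpleGraph.Reachable.refl _
      · obtain ⟨h1, h2, h3⟩ := parent_spec v u hu hr
        have hadj : (blowup.induce ({v}ᶜ : Set (Fin 50))).Adj ⟨u, hu⟩ ⟨parent v u, h1⟩ := h2
        exact hadj.reachable.trans (ih _ h1 (by omega))
  exact
    { preconnected := fun x y =>
        (key _ x.1 x.2 (Nat.lt_succ_self _)).trans (key _ y.1 y.2 (Nat.lt_succ_self _)).symm
      nonempty := ⟨⟨root v, root_ne v⟩⟩ }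

end blowup

theorem SimpleGraph.Reachable.mem_of_closed {V : Type*} {G : SimpleGraph V} {S : Set V} {u v : V}
    (h : G.Reachable u v) (hS : ∀ x y, G.Adj x y → x ∈ S → y ∈ S) (hu : u ∈ S) : v ∈ S := by
  obtain ⟨p⟩ := h
  induction p with
  | nil => exact hu
  | cons hadj _ ih => exact ih (hS _ _ hadj hu)

namespace blowup

theorem adj_tip : ∀ (i : Fin 3) (x : Fin 50), blowup.Adj ⟨6 + i, by omega⟩ x →
    x = ⟨i, by omega⟩ ∨ x = ⟨3 + i, by omega⟩ := by decide +kernel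

theorem adj_corner : ∀ (i : Fin 3) (x : Fin 50), blowup.Adj ⟨3 + i, by omega⟩ x →
    x = ⟨i, by omega⟩ ∨ x = ⟨6 + i, by omega⟩ ∨
      ∃ j ≠ i, x = ⟨3 + j.val, by omega⟩ := by decide +kernel

end blowup

theorem not_isHamiltonian_blowup : ¬ blowup.IsHamiltonian := by
  intro h
  obtain ⟨w, p, hp⟩ := h (by simp)
  have hmem (x : Fin 50) : x ∈ p.support := hp.mem_support x
  set H := p.toSubgraph with hH
  have hdeg (x : Fin 50) : (H.neighborSet x).ncard = 2 :=
    hp.isCycle.ncard_neighborSet_toSubgraph_eq_two (hmem x)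
  have eq_pair {x y z : Fin 50} (hyz : y ≠ z) (hy : H.Adj x y) (hz : H.Adj x z) :
      ∀ t, H.Adj x t → t = y ∨ t = z := by
    have hsub : ({y, z} : Set (Fin 50)) ⊆ H.neighborSet x := by
      rintro t (rfl | rfl) <;> assumption
    have := Set.eq_of_subset_of_ncard_le hsub (by rw [hdeg, Set.ncard_pair hyz])
      (Set.toFinite _)
    intro t ht
    have ht' : t ∈ H.neighborSet x := ht
    rw [← this] at ht'
    exact ht'
  have exists_pair (x : Fin 50) : ∃ y z, y ≠ z ∧ H.Adj x y ∧ H.Adj x z := by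
    obtain ⟨y, z, hyz, hs⟩ := Set.ncard_eq_two.1 (hdeg x)
    refine ⟨y, z, hyz, ?_, ?_⟩ <;> rw [← SimpleGraph.Subgraph.mem_neighborSet, hs] <;> simp
  let foot (i : Fin 3) : Fin 50 := ⟨i, by omega⟩
  let corner (i : Fin 3) : Fin 50 := ⟨3 + i, by omega⟩
  let tip (i : Fin 3) : Fin 50 := ⟨6 + i, by omega⟩
  have foot_ne_corner (i : Fin 3) : foot i ≠ corner i := by simp [foot, corner, Fin.ext_iff]
  have foot_ne_tip (i : Fin 3) : foot i ≠ tip i := by simp [foot, tip, Fin.ext_iff]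
  have corner_ne_tip (i j : Fin 3) : corner j ≠ tip i := by
    simp only [corner, tip, ne_eq, Fin.ext_iff]; omega
  have htip (i : Fin 3) : H.Adj (tip i) (foot i) ∧ H.Adj (tip i) (corner i) := by
    obtain ⟨y, z, hyz, hy, hz⟩ := exists_pair (tip i)
    rcases blowup.adj_tip i y hy.adj_sub with rfl | rfl <;>
      rcases blowup.adj_tip i z hz.adj_sub with rfl | rfl
    · exact absurd rfl hyz
    · exact ⟨hy, hz⟩
    · exact ⟨hz, hy⟩
    · exact absurd rfl hyz
  have hfoot (i : Fin 3) : ¬ H.Adj (corner i) (foot i) := by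
    intro hcf
    obtain ⟨htf, htc⟩ := htip i
    have hclosed : ∀ x y, H.Adj x y → x ∈ ({foot i, corner i, tip i} : Set (Fin 50)) →
        y ∈ ({foot i, corner i, tip i} : Set (Fin 50)) := by
      rintro x y hxy (rfl | rfl | rfl)
      · rcases eq_pair (corner_ne_tip i i) hcf.symm htf.symm y hxy with rfl | rfl <;> simp
      · rcases eq_pair (foot_ne_tip i) hcf htc.symm y hxy with rfl | rfl <;> simp
      · rcases eq_pair (foot_ne_corner i) htf htc y hxy with rfl | rfl <;> simp
    have hr := p.toSubgraph_connected.preconnected ⟨foot i, by simpa using hmem _⟩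
      ⟨49, by simpa using hmem _⟩
    have := hr.mem_of_closed
      (S := {x : p.toSubgraph.verts | x.1 ∈ ({foot i, corner i, tip i} : Set (Fin 50))})
      (fun x y hxy hx => hclosed x.1 y.1 hxy hx) (by simp)
    simp only [Set.mem_ofPred_eq, Set.mem_insert_iff, Set.mem_singleton_iff, foot, corner, tip,
      Fin.ext_iff] at this
    have h49 : ((49 : Fin 50) : ℕ) = 49 := rfl
    omega
  have hcorner (i : Fin 3) : ∃ j ≠ i, H.Adj (corner i) (corner j) := by
    obtain ⟨y, z, hyz, hy, hz⟩ := exists_pair (corner i)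
    rcases blowup.adj_corner i y hy.adj_sub with rfl | rfl | ⟨j, hj, rfl⟩
    · exact absurd hy (hfoot i)
    · rcases blowup.adj_corner i z hz.adj_sub with rfl | rfl | ⟨j, hj, rfl⟩
      · exact absurd hz (hfoot i)
      · exact absurd rfl hyz
      · exact ⟨j, hj, hz⟩
    · exact ⟨j, hj, hy⟩
  have corner_unique (i j k : Fin 3) (hj : H.Adj (corner i) (corner j))
      (hk : H.Adj (corner i) (corner k)) : j = k := by
    rcases eq_pair (corner_ne_tip i j) hj (htip i).2.symm _ hk with h | h
    · simp only [corner, Fin.ext_iff] at h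
      omega
    · exact absurd h (corner_ne_tip i k)
  choose f hne hf using hcorner
  have hinv (i : Fin 3) : f (f i) = i := corner_unique (f i) _ _ (hf (f i)) (hf i).symm
  have : ∀ g : Fin 3 → Fin 3, ¬ ∀ i, g i ≠ i ∧ g (g i) = i := by decide
  exact this f fun i => ⟨hne i, hinv i⟩

/-- If `γ` is a symmetrical graph on `I` with `13, 46 ∈ E(γ)` (paper indexing; here
`s(0,2)` and `s(3,5)`) such that every 2-connected claw-o-heavy and `P₆`-`γ`-heavy graph
is hamiltonian, then none of `11, 16, 66` (here `s(0,0)`, `s(0,5)`, `s(5,5)`) is an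
edge of `γ`. -/
theorem stmt_8 (γ : Set (Sym2 (Fin 6))) (hsym : SymmetricalGamma γ)
    (h13 : s(0,2) ∈ γ) (h46 : s(3,5) ∈ γ)
    (hham : ∀ (V : Type) [Fintype V] [DecidableEq V] (G : SimpleGraph V) [DecidableRel G.Adj],
      TwoConnected G → ClawOHeavy G → P6GammaHeavy G γ → G.IsHamiltonian) :
    s(0,0) ∉ γ ∧ s(0,5) ∉ γ ∧ s(5,5) ∉ γ := by
  have not_heavy : ¬ P6GammaHeavy blowup γ := fun h =>
    not_isHamiltonian_blowup (hham _ blowup blowup.twoConnected blowup.clawOHeavy h)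
  have heavy (i j : Fin 6) (hi : i = 0 ∨ i = 5) (hj : j = 0 ∨ j = 5) (hij : s(i, j) ∈ γ) :
      P6GammaHeavy blowup γ := by
    intro v hv
    simp only [Fintype.card_fin]
    rcases blowup.heavy_of_isInducedP6 hv with h | h | ⟨h0, h5⟩
    · exact ⟨0, 2, h13, h⟩
    · exact ⟨3, 5, h46, h⟩
    · refine ⟨i, j, hij, ?_⟩
      rcases hi with rfl | rfl <;> rcases hj with rfl | rfl <;> omega
  exact ⟨fun h => not_heavy (heavy 0 0 (by simp) (by simp) h),
    fun h => not_heavy (heavy 0 5 (by simp) (by simp) h),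
    fun h => not_heavy (heavy 5 5 (by simp) (by simp) h)⟩
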